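/- arXiv:2111.00397 — 3 statements merged into one kernel-verified Lean document; each statement's English description precedes it below -/
import Mathlib

section
/- The ⋄-chain computes the carry: let G, P : ℕ → Z_2 and define c(0) = 0, c(i+1) = G(i) + P(i)·c(i). Define pairs q(1) = (G(0), P(0)) and q(n+1) = (G(n), P(n)) ⋄ q(n) for n ≥ 1, where (G″, P″) ⋄ (G′, P′) = (G″ + G′·P″, P″·P′). Then for every n ≥ 1, the first component of q(n) equals c(n) and the second component of q(n) equals Π_{j=0}^{n−1} P(j). -/
/-- The carry look-ahead operator `(G″, P″) ⋄ (G′, P′) = (G″ + G′·P″, P″·P′)`. -/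
def diamond {R : Type*} [CommRing R] (a b : R × R) : R × R :=
  (a.1 + b.1 * a.2, a.2 * b.2)

/-- The ⋄-chain computes the carry: with `c 0 = 0`, `c (i+1) = G i + P i * c i`,
`q 1 = (G 0, P 0)` and `q (n+1) = (G n, P n) ⋄ q n` for `n ≥ 1`, for every `n ≥ 1`
the first component of `q n` is `c n` and the second is `Π_{j=0}^{n-1} P j`. -/
theorem diamond_chain_computes_carry (G P : ℕ → ZMod 2) (c : ℕ → ZMod 2)
    (q : ℕ → ZMod 2 × ZMod 2)
    (hc0 : c 0 = 0) (hc : ∀ i, c (i + 1) = G i + P i * c i)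
    (hq1 : q 1 = (G 0, P 0))
    (hq : ∀ n, 1 ≤ n → q (n + 1) = diamond (G n, P n) (q n)) :
    ∀ n, 1 ≤ n → (q n).1 = c n ∧ (q n).2 = ∏ j ∈ Finset.range n, P j := by
  intro n hn
  induction n, hn using Nat.le_induction with
  | base =>
    have h := hc 0
    simp only [hc0, mul_zero, add_zero, zero_add] at h
    simp [hq1, h]
  | succ k hk ih =>
    obtain ⟨h1, h2⟩ := ih
    rw [hq k hk, hc k, Finset.prod_range_succ, ← h1, ← h2]
    constructor
    · simp only [diamond]
      ring
    · simp only [diamond]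
      ring
end

section
/- Correctness of polynomial-based decision tree inference: let d be a natural number, let v : List Bool → Bool assign to each node (identified with the bit string of branch choices leading to it) its decision bit, and let u assign to each leaf (bit string of length d) a prediction value in a commutative ring R. Define the traversal path t(0) = [] and t(k+1) = t(k) ++ [v(t(k))], and for each bit string s of length d define g(s) = Π_{k=0}^{d−1} (1 if v(s.take k) = s_k, else 0) ∈ R. Then Σ over all bit strings s of length d of u(s)·g(s) = u(t(d)). -/
/-- Correctness of polynomial-based decision tree inference: with decision bits
`v`, leaf values `u`, traversal path `t 0 = []`, `t (k+1) = t k ++ [v (t k)]`,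
and path terms `g s = Π_{k<d} (if v (s.take k) = s_k then 1 else 0)`, the sum of
`u s * g s` over all bit strings `s` of length `d` equals `u (t d)`. -/
theorem polynomial_tree_inference_correct {R : Type*} [CommRing R] (d : ℕ)
    (v : List Bool → Bool) (u : List Bool → R)
    (t : ℕ → List Bool) (ht0 : t 0 = []) (ht : ∀ k, t (k + 1) = t k ++ [v (t k)])
    (g : List Bool → R)
    (hg : ∀ s : List Bool,
      g s = ∏ k ∈ Finset.range d, if v (s.take k) = s.getD k false then (1 : R) else 0) :
    ∑ s : Fin d → Bool, u (List.ofFn s) * g (List.ofFn s) = u (t d) := by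
  have hof : ∀ n, t n = List.ofFn (fun i : Fin n => v (t i)) := by
    intro n
    induction n with
    | zero => simp [ht0]
    | succ n ih =>
      rw [List.ofFn_succ_last, ht]
      simp only [Fin.val_castSucc, Fin.val_last]
      rw [← ih]
  have hlen : ∀ n, (t n).length = n := by
    intro n
    rw [hof n, List.length_ofFn]
  have htake : ∀ n k, k ≤ n → (t n).take k = t k := by
    intro n k hk
    induction n, hk using Nat.le_induction with
    | base => exact List.take_of_length_le (hlen k).le
    | succ n hk ih =>
      rw [ht, List.take_append_of_le_length (by rw [hlen]; exact hk), ih]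
  have hget : ∀ (s : Fin d → Bool) (k : ℕ) (hk : k < d),
      (List.ofFn s).getD k false = s ⟨k, hk⟩ := by
    intro s k hk
    rw [List.getD_eq_getElem _ _ (by simpa using hk)]
    simp
  rw [Finset.sum_eq_single (fun i : Fin d => v (t i))]
  · have h1 : g (List.ofFn (fun i : Fin d => v (t i))) = 1 := by
      rw [hg]
      apply Finset.prod_eq_one
      intro k hk
      have hk' := Finset.mem_range.mp hk
      rw [hget _ k hk', ← hof d, htake d k hk'.le]
      simp
    rw [h1, mul_one, ← hof d]
  · intro s _ hs
    by_cases hall : ∀ k (hk : k < d), v ((List.ofFn s).take k) = s ⟨k, hk⟩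
    · exfalso
      have key : ∀ k, k ≤ d → (List.ofFn s).take k = t k := by
        intro k
        induction k with
        | zero => simp [ht0]
        | succ k ih =>
          intro hk
          have h1 := ih (by omega)
          have h2 := hall k (by omega)
          rw [List.take_succ_eq_append_getElem (by simpa using hk), ht, ← h1, h2]
          simp
      apply hs
      funext i
      rw [← key i i.2.le, hall i i.2]
    · push Not at hall
      obtain ⟨k, hk, hne⟩ := hall
      rw [hg, Finset.prod_eq_zero (Finset.mem_range.mpr hk), mul_zero]
      rw [hget s k hk, if_neg hne]
  · intro h
    exact absurd (Finset.mem_univ _) h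
end

section
/- End-to-end correctness of secure decision node evaluation: let l ≥ 1 and let x, y be natural numbers with x < 2^{l−1} and y < 2^{l−1}. Let a, b < 2^l be natural numbers with (a + b) mod 2^l = (2^l + y − x) mod 2^l (i.e. a and b are additive shares over Z_{2^l} of the difference Δ = y − x). Define the carry sequence c(0) = 0, c(i+1) = majority(a_i, b_i, c(i)), where a_i, b_i are the i-th bits of a and b. Then a_{l−1} XOR b_{l−1} XOR c(l−1) = 1 if and only if y < x. -/
theorem mod_two_pow_step (x i : ℕ) : x % 2 ^ (i + 1) = x % 2 ^ i + 2 ^ i * (x.testBit i).toNat := by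
  rw [Nat.mod_pow_succ, Nat.toNat_testBit]

/-- End-to-end correctness of secure decision node evaluation: for `x, y < 2^(l-1)`
and additive shares `a, b < 2^l` with `(a + b) mod 2^l = (2^l + y - x) mod 2^l`,
and carries `c 0 = false`, `c (i+1) = majority (aᵢ, bᵢ, c i)`, the extracted MSB
`a_{l-1} XOR b_{l-1} XOR c (l-1)` is `1` iff `y < x`. -/
theorem secure_node_eval_correct (l x y a b : ℕ) (hl : 1 ≤ l)
    (hx : x < 2 ^ (l - 1)) (hy : y < 2 ^ (l - 1))
    (ha : a < 2 ^ l) (hb : b < 2 ^ l)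
    (hab : (a + b) % 2 ^ l = (2 ^ l + y - x) % 2 ^ l)
    (c : ℕ → Bool) (h0 : c 0 = false)
    (hc : ∀ i, c (i + 1)
      = decide (2 ≤ (a.testBit i).toNat + (b.testBit i).toNat + (c i).toNat)) :
    (Bool.xor (Bool.xor (a.testBit (l - 1)) (b.testBit (l - 1))) (c (l - 1)) = true)
      ↔ y < x := by
  have key : ∀ i, c i = decide (2 ^ i ≤ a % 2 ^ i + b % 2 ^ i) := by
    intro i
    induction i with
    | zero => simp [h0, Nat.mod_one]
    | succ i ih =>
      rw [hc, ih, mod_two_pow_step, mod_two_pow_step, pow_succ]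
      have h1 := Nat.mod_lt a (Nat.two_pow_pos i)
      have h2 := Nat.mod_lt b (Nat.two_pow_pos i)
      generalize a % 2 ^ i = p at *
      generalize b % 2 ^ i = q at *
      generalize 2 ^ i = M at *
      by_cases h : M ≤ p + q <;> cases a.testBit i <;> cases b.testBit i <;>
        simp [h] <;> omega
  obtain ⟨m, rfl⟩ : ∃ m, l = m + 1 := ⟨l - 1, by omega⟩
  simp only [Nat.add_sub_cancel] at *
  rw [key m]
  have ea := mod_two_pow_step a m
  have eb := mod_two_pow_step b m
  rw [Nat.mod_eq_of_lt ha] at ea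
  rw [Nat.mod_eq_of_lt hb] at eb
  have h1 := Nat.mod_lt a (Nat.two_pow_pos m)
  have h2 := Nat.mod_lt b (Nat.two_pow_pos m)
  rw [pow_succ] at *
  generalize a % 2 ^ m = p at *
  generalize b % 2 ^ m = q at *
  generalize a.testBit m = s at *
  generalize b.testBit m = t at *
  clear hc key
  generalize 2 ^ m = M at *
  have hL : (a + b) % (M * 2) = if a + b < M * 2 then a + b else a + b - M * 2 := by
    split_ifs with h
    · exact Nat.mod_eq_of_lt h
    · rw [Nat.mod_eq_sub_mod (by omega), Nat.mod_eq_of_lt (by omega)]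
  have hR : (M * 2 + y - x) % (M * 2) = if y < x then M * 2 + y - x else y - x := by
    split_ifs with h
    · exact Nat.mod_eq_of_lt (by omega)
    · rw [Nat.mod_eq_sub_mod (by omega), Nat.mod_eq_of_lt (by omega)]
      omega
  rw [hL, hR] at hab
  clear hL hR
  by_cases h : M ≤ p + q <;> cases s <;> cases t <;> simp [h] <;>
    simp at ea eb <;> split_ifs at hab <;> omega
end
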